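/- Let (X_n)_{n≥1} be real random variables with Lebesgue densities (p_n)_{n≥1}, E X_n = 0 and Var(X_n) = 1 for all n, and suppose there exists s > 2 with sup_n E|X_n|^s < ∞. Assume that either (i) there exists q with 2 < q ≤ ∞ such that sup_n ‖p_n − φ‖_q < ∞, or (ii) limsup_n ‖p_n‖_2 ≤ ‖φ‖_2. Then the following are equivalent as n → ∞: (1) ‖p_n − φ‖_1 → 0; (2) ‖p_n − φ‖_2 → 0; (3) KL(X_n‖G) → 0. -/

import Mathlib

open MeasureTheory Real Filter
open scoped ENNReal

noncomputable section

/-- `p` is the Lebesgue density of the real random variable `X` defined on `(Ω, P)`. -/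
def IsDensityOf {Ω : Type*} [MeasurableSpace Ω] (P : Measure Ω) (X : Ω → ℝ) (p : ℝ → ℝ) : Prop :=
  Measurable X ∧ Measurable p ∧ (∀ x, 0 ≤ p x) ∧
    Measure.map X P = volume.withDensity (fun x => ENNReal.ofReal (p x))

/-- The standard Gaussian density on `ℝ`. -/
def gauss (x : ℝ) : ℝ := (Real.sqrt (2 * Real.pi))⁻¹ * Real.exp (-x ^ 2 / 2)

/-- Kullback–Leibler divergence between densities:  `∫ p_X ln (p_X / p_Y)`. -/
def KLdiv (pX pY : ℝ → ℝ) : ℝ := ∫ x, pX x * Real.log (pX x / pY x)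

/-- A density on `ℝ` with unit mass and unit second moment. -/
structure IsUnitDensity (p : ℝ → ℝ) : Prop where
  measurable : Measurable p
  nonneg : ∀ x, 0 ≤ p x
  integrable : Integrable p
  integral_eq_one : ∫ x, p x = 1
  integrable_sq_mul : Integrable (fun x => p x * x ^ 2)
  integral_sq_mul : ∫ x, p x * x ^ 2 = 1

lemma IsDensityOf.isUnitDensity {Ω : Type*} [MeasurableSpace Ω] {P : Measure Ω}
    [IsProbabilityMeasure P] {X : Ω → ℝ} {p : ℝ → ℝ} (h : IsDensityOf P X p)
    (hi : Integrable (fun ω => (X ω) ^ 2) P) (hv : ∫ ω, (X ω) ^ 2 ∂P = 1) :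
    IsUnitDensity p := by
  obtain ⟨hX, hp, hp0, hmap⟩ := h
  have hm : Measurable (fun x => ENNReal.ofReal (p x)) := hp.ennreal_ofReal
  have hlt : ∀ᵐ x, ENNReal.ofReal (p x) < ⊤ := by simp
  have key : ∀ g : ℝ → ℝ, Measurable g → Integrable (fun ω => g (X ω)) P →
      Integrable (fun x => p x * g x) ∧ ∫ x, p x * g x = ∫ ω, g (X ω) ∂P := by
    intro g hg hgi
    have h1 : Integrable g (Measure.map X P) :=
      (integrable_map_measure hg.aestronglyMeasurable hX.aemeasurable).2 hgi
    have h2 : ∫ x, g x ∂(Measure.map X P) = ∫ ω, g (X ω) ∂P :=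
      integral_map hX.aemeasurable hg.aestronglyMeasurable
    rw [hmap] at h1 h2
    rw [integrable_withDensity_iff_integrable_smul' hm hlt] at h1
    rw [integral_withDensity_eq_integral_toReal_smul hm hlt] at h2
    simp only [ENNReal.toReal_ofReal (hp0 _), smul_eq_mul] at h1 h2
    exact ⟨h1, h2⟩
  have k1 := key (fun _ => 1) measurable_const (integrable_const _)
  have k2 := key (fun x => x ^ 2) (by fun_prop) hi
  simp only [mul_one, integral_const, probReal_univ, smul_eq_mul] at k1
  exact ⟨hp, hp0, k1.1, k1.2, k2.1, k2.2.trans hv⟩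

lemma gauss_eq_gaussianPDFReal : gauss = ProbabilityTheory.gaussianPDFReal 0 1 := by
  ext x
  simp [gauss, ProbabilityTheory.gaussianPDFReal]

lemma gauss_pos (x : ℝ) : 0 < gauss x := by
  unfold gauss; positivity

lemma one_le_sqrt_two_pi : 1 ≤ √(2 * π) := by
  rw [Real.one_le_sqrt]
  linarith [Real.pi_gt_three]

lemma gauss_le_exp_pow_four (x : ℝ) : gauss x ≤ Real.exp (-(1 / 8) * x ^ 2) ^ 4 := by
  rw [← Real.exp_nat_mul, show ((4 : ℕ) : ℝ) * (-(1 / 8) * x ^ 2) = -x ^ 2 / 2 by push_cast; ring]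
  unfold gauss
  have : (√(2 * π))⁻¹ ≤ 1 := inv_le_one_of_one_le₀ one_le_sqrt_two_pi
  nlinarith [Real.exp_pos (-x ^ 2 / 2)]

lemma exp_neg_mul_sq_le_one (x : ℝ) : Real.exp (-(1 / 8) * x ^ 2) ≤ 1 :=
  Real.exp_le_one_iff.2 (by nlinarith [sq_nonneg x])

lemma gauss_le_one (x : ℝ) : gauss x ≤ 1 :=
  (gauss_le_exp_pow_four x).trans (pow_le_one₀ (Real.exp_pos _).le (exp_neg_mul_sq_le_one x))

lemma log_gauss (x : ℝ) : Real.log (gauss x) = -Real.log (√(2 * π)) - x ^ 2 / 2 := by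
  have : √(2 * π) ≠ 0 := by positivity
  rw [gauss, Real.log_mul (by positivity) (Real.exp_ne_zero _), Real.log_inv, Real.log_exp]
  ring

lemma isUnitDensity_gauss : IsUnitDensity gauss := by
  have hd : IsDensityOf (ProbabilityTheory.gaussianReal 0 1) id gauss := by
    refine ⟨measurable_id, ?_, fun x => (gauss_pos x).le, ?_⟩
    · unfold gauss; fun_prop
    · rw [Measure.map_id, ProbabilityTheory.gaussianReal_of_var_ne_zero _ one_ne_zero,
        gauss_eq_gaussianPDFReal]
      rfl
  refine hd.isUnitDensity ?_ ?_
  · exact (ProbabilityTheory.memLp_id_gaussianReal 2).integrable_sq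
  · rw [← ProbabilityTheory.variance_of_integral_eq_zero aemeasurable_id
      (by simp [ProbabilityTheory.integral_id_gaussianReal]),
      ProbabilityTheory.variance_id_gaussianReal]
    simp

lemma integrable_gauss_sq : Integrable (fun x => gauss x ^ 2) := by
  refine Integrable.mono' isUnitDensity_gauss.integrable
    (isUnitDensity_gauss.measurable.pow_const 2).aestronglyMeasurable (ae_of_all _ fun x => ?_)
  rw [Real.norm_of_nonneg (sq_nonneg _)]
  nlinarith [gauss_pos x, gauss_le_one x]

lemma le_mul_add_sq_div {r w δ : ℝ} (hw : 0 ≤ w) (hr : r ≤ w ^ 2) (hδ : 0 < δ) :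
    r ≤ δ * w + r ^ 2 / δ ^ 2 := by
  by_cases h : r ≤ δ * w
  · have : 0 ≤ r ^ 2 / δ ^ 2 := by positivity
    linarith
  · push Not at h
    have h1 : w ≤ r / δ := by rw [le_div_iff₀ hδ]; linarith
    have h2 : w ^ 2 ≤ (r / δ) ^ 2 := by gcongr
    rw [div_pow] at h2
    have : 0 ≤ δ * w := by positivity
    linarith

lemma mul_log_sub_mul_log_le {a b : ℝ} (ha : 0 ≤ a) (hb : 0 < b) (hb1 : b ≤ 1) :
    a * Real.log a - b * Real.log b ≤ (a - b) ^ 2 + 2 * |a - b| + 2 * √(max (b - a) 0) := by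
  rcases le_or_gt b a with h | h
  · have ha' : 0 < a := hb.trans_le h
    have h1 : Real.log a ≤ a := Real.log_le_self ha
    have h2 : Real.log a - Real.log b ≤ a / b - 1 := by
      rw [← Real.log_div ha'.ne' hb.ne']
      exact Real.log_le_sub_one_of_pos (by positivity)
    have h3 : b * (Real.log a - Real.log b) ≤ a - b := by
      have := mul_le_mul_of_nonneg_left h2 hb.le
      rwa [mul_sub b (a / b), mul_div_cancel₀ _ hb.ne', mul_one] at this
    have h4 : (a - b) * Real.log a ≤ (a - b) * a :=
      mul_le_mul_of_nonneg_left h1 (sub_nonneg.2 h)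
    have h5 : 0 ≤ √(max (b - a) 0) := Real.sqrt_nonneg _
    rw [abs_of_nonneg (sub_nonneg.2 h)]
    nlinarith [mul_nonneg (sub_nonneg.2 h) (sub_nonneg.2 hb1)]
  · set u := b - a with hu
    have hu0 : 0 < u := sub_pos.2 h
    rw [max_eq_left hu0.le]
    have h1 : a * Real.log a ≤ a * Real.log b := by
      rcases ha.eq_or_lt with rfl | ha'
      · simp
      · exact mul_le_mul_of_nonneg_left (Real.log_le_log ha' h.le) ha
    have h2 : Real.log u ≤ Real.log b := Real.log_le_log hu0 (by linarith)
    have hs : 0 < √u := Real.sqrt_pos.2 hu0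
    have h3 : -Real.log u ≤ 2 / √u := by
      have h4 : Real.log (√u)⁻¹ ≤ (√u)⁻¹ := Real.log_le_self (by positivity)
      rw [Real.log_inv, Real.log_sqrt hu0.le] at h4
      rw [div_eq_mul_inv]
      linarith
    have h4 : u * -Real.log u ≤ 2 * √u := by
      calc u * -Real.log u ≤ u * (2 / √u) := mul_le_mul_of_nonneg_left h3 hu0.le
        _ = 2 * √u := by
          rw [mul_div_assoc', mul_comm, mul_div_assoc, Real.div_sqrt]
    have h5 : u * Real.log u ≤ u * Real.log b := mul_le_mul_of_nonneg_left h2 hu0.le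
    have h6 : a * Real.log a - b * Real.log b ≤ -(u * Real.log b) := by
      rw [hu]; linarith
    have := abs_nonneg (a - b)
    nlinarith [sq_nonneg (a - b)]

lemma sq_sqrt_sub_sqrt_le {a b : ℝ} (ha : 0 ≤ a) (hb : 0 < b) :
    (√a - √b) ^ 2 ≤ a * Real.log (a / b) - (a - b) := by
  rcases ha.eq_or_lt with rfl | ha'
  · simp [Real.sq_sqrt hb.le]
  · have hsa : 0 < √a := Real.sqrt_pos.2 ha'
    have hsb : 0 < √b := Real.sqrt_pos.2 hb
    have h1 : Real.log (√b / √a) ≤ √b / √a - 1 := Real.log_le_sub_one_of_pos (by positivity)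
    have h2 : Real.log (√b / √a) = -(Real.log (a / b) / 2) := by
      rw [Real.log_div hsb.ne' hsa.ne', Real.log_sqrt hb.le, Real.log_sqrt ha,
        Real.log_div ha'.ne' hb.ne']
      ring
    have h3 : a * (√b / √a) = √a * √b := by
      rw [mul_div_assoc', mul_comm, mul_div_assoc, Real.div_sqrt, mul_comm]
    have h4 := mul_le_mul_of_nonneg_left h1 ha
    rw [h2, mul_sub, h3] at h4
    nlinarith [Real.sq_sqrt ha, Real.sq_sqrt hb.le]

lemma abs_sub_le_of_mul_log {a b δ : ℝ} (ha : 0 ≤ a) (hb : 0 < b) (hδ : 0 < δ) :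
    |a - b| ≤ δ⁻¹ * (a * Real.log (a / b) - (a - b)) + δ * (a + b) := by
  have h1 : |a - b| = |√a - √b| * (√a + √b) := by
    rw [← abs_of_nonneg (add_nonneg (Real.sqrt_nonneg a) (Real.sqrt_nonneg b)), ← abs_mul]
    congr 1
    nlinarith [Real.sq_sqrt ha, Real.sq_sqrt hb.le]
  set s := |√a - √b|
  set t := √a + √b
  have h2 : s ^ 2 ≤ a * Real.log (a / b) - (a - b) := by
    rw [sq_abs]; exact sq_sqrt_sub_sqrt_le ha hb
  have h3 : t ^ 2 ≤ 2 * (a + b) := by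
    nlinarith [Real.sq_sqrt ha, Real.sq_sqrt hb.le, sq_nonneg (√a - √b)]
  have h4 : s * t ≤ δ⁻¹ * s ^ 2 + δ * (t ^ 2 / 2) := by
    have e : δ⁻¹ * s ^ 2 + δ * (t ^ 2 / 2) - s * t
        = δ⁻¹ * ((s - δ * t / 2) ^ 2 + (δ * t / 2) ^ 2) := by
      field_simp; ring
    have : 0 ≤ δ⁻¹ * ((s - δ * t / 2) ^ 2 + (δ * t / 2) ^ 2) := by positivity
    linarith
  have h5 : δ⁻¹ * s ^ 2 ≤ δ⁻¹ * (a * Real.log (a / b) - (a - b)) := by gcongr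
  have h6 : δ * (t ^ 2 / 2) ≤ δ * (a + b) := by gcongr; linarith
  rw [h1]; linarith

namespace IsUnitDensity

variable {p : ℝ → ℝ}

lemma integrable_sub_gauss (hp : IsUnitDensity p) : Integrable (fun x => p x - gauss x) :=
  hp.integrable.sub isUnitDensity_gauss.integrable

lemma integral_sub_gauss (hp : IsUnitDensity p) : ∫ x, (p x - gauss x) = 0 := by
  rw [integral_sub hp.integrable isUnitDensity_gauss.integrable, hp.integral_eq_one,
    isUnitDensity_gauss.integral_eq_one, sub_self]

lemma measurable_mul_log_div_gauss (hp : IsUnitDensity p) :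
    Measurable (fun x => p x * Real.log (p x / gauss x)) :=
  hp.measurable.mul (hp.measurable.div isUnitDensity_gauss.measurable).log

/-- Convergence in `L²` to the Gaussian density implies convergence in `L¹`, quantitatively. -/
lemma integral_abs_sub_gauss_le (hp : IsUnitDensity p)
    (h2 : Integrable (fun x => (p x - gauss x) ^ 2)) {δ : ℝ} (hδ : 0 < δ) :
    ∫ x, |p x - gauss x| ≤ 2 * (δ ^ 2)⁻¹ * (∫ x, (p x - gauss x) ^ 2)
      + 2 * δ * ∫ x : ℝ, Real.exp (-(1 / 8) * x ^ 2) := by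
  have hw := integrable_exp_neg_mul_sq (b := 1 / 8) (by norm_num)
  have hb : ∀ x, |p x - gauss x| ≤ 2 * (δ ^ 2)⁻¹ * (p x - gauss x) ^ 2
      + 2 * δ * Real.exp (-(1 / 8) * x ^ 2) + (p x - gauss x) := by
    intro x
    have hw0 := Real.exp_pos (-(1 / 8) * x ^ 2)
    have hw1 := exp_neg_mul_sq_le_one x
    have hg := gauss_le_exp_pow_four x
    set w := Real.exp (-(1 / 8) * x ^ 2)
    rcases le_or_gt (gauss x) (p x) with h | h
    · rw [abs_of_nonneg (sub_nonneg.2 h)]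
      have : 0 ≤ 2 * (δ ^ 2)⁻¹ * (p x - gauss x) ^ 2 + 2 * δ * w := by positivity
      linarith
    · have h3 : w ^ 4 ≤ w ^ 2 := pow_le_pow_of_le_one hw0.le hw1 (by norm_num)
      have := le_mul_add_sq_div (r := gauss x - p x) hw0.le
        (by linarith [hp.nonneg x]) hδ
      rw [abs_of_neg (sub_neg.2 h)]
      rw [div_eq_inv_mul, sub_sq_comm] at this
      linarith
  have i1 := h2.const_mul (2 * (δ ^ 2)⁻¹)
  have i2 := hw.const_mul (2 * δ)
  have i12 : Integrable (fun x => 2 * (δ ^ 2)⁻¹ * (p x - gauss x) ^ 2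
      + 2 * δ * Real.exp (-(1 / 8) * x ^ 2)) := i1.add i2
  calc ∫ x, |p x - gauss x| ≤ ∫ x, (2 * (δ ^ 2)⁻¹ * (p x - gauss x) ^ 2
        + 2 * δ * Real.exp (-(1 / 8) * x ^ 2) + (p x - gauss x)) :=
        integral_mono hp.integrable_sub_gauss.abs (i12.add hp.integrable_sub_gauss) hb
    _ = _ := by
        rw [integral_add i12 hp.integrable_sub_gauss, integral_add i1 i2, integral_const_mul,
          integral_const_mul, hp.integral_sub_gauss, add_zero]

/-- Upper bound for the relative entropy integrand whose last two terms integrate to zero. -/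
lemma mul_log_div_gauss_le (hp : IsUnitDensity p) {δ : ℝ} (hδ : 0 < δ) (x : ℝ) :
    p x * Real.log (p x / gauss x) ≤ (p x - gauss x) ^ 2
      + (2 + 2 * (δ ^ 2)⁻¹) * |p x - gauss x| + 2 * δ * Real.exp (-(1 / 8) * x ^ 2)
      + Real.log (√(2 * π)) * (p x - gauss x)
      + (p x * x ^ 2 - gauss x * x ^ 2) / 2 := by
  have hw0 := Real.exp_pos (-(1 / 8) * x ^ 2)
  have hg := gauss_le_exp_pow_four x
  have hg0 := gauss_pos x
  have hl := log_gauss x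
  have hp0 := hp.nonneg x
  have h1 := mul_log_sub_mul_log_le hp0 hg0 (gauss_le_one x)
  set w := Real.exp (-(1 / 8) * x ^ 2)
  set u := max (gauss x - p x) 0 with hu
  have hu0 : 0 ≤ u := le_max_right _ _
  have huw : u ≤ w ^ 4 := max_le (by linarith) (by positivity)
  have hua : u ≤ |p x - gauss x| := max_le (by rw [abs_sub_comm]; exact le_abs_self _) (abs_nonneg _)
  have h2 : √u ≤ w ^ 2 := by
    rw [Real.sqrt_le_left (by positivity)]
    calc u ≤ w ^ 4 := huw
      _ = (w ^ 2) ^ 2 := by ring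
  have h3 := le_mul_add_sq_div hw0.le h2 hδ
  rw [Real.sq_sqrt hu0, div_eq_inv_mul] at h3
  have h4 : (δ ^ 2)⁻¹ * u ≤ (δ ^ 2)⁻¹ * |p x - gauss x| := by gcongr
  have h5 : p x * Real.log (p x / gauss x) = p x * Real.log (p x) - p x * Real.log (gauss x) := by
    rcases hp0.eq_or_lt with h | h
    · simp [← h]
    · rw [Real.log_div h.ne' hg0.ne']; ring
  rw [h5]
  rw [hl] at h1 ⊢
  linarith

lemma sub_gauss_le_mul_log (hp : IsUnitDensity p) (x : ℝ) :
    p x - gauss x ≤ p x * Real.log (p x / gauss x) := by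
  linarith [sq_sqrt_sub_sqrt_le (hp.nonneg x) (gauss_pos x), sq_nonneg (√(p x) - √(gauss x))]

lemma integrable_upper_bound (hp : IsUnitDensity p)
    (h2 : Integrable (fun x => (p x - gauss x) ^ 2)) (δ : ℝ) :
    Integrable (fun x => (p x - gauss x) ^ 2
      + (2 + 2 * (δ ^ 2)⁻¹) * |p x - gauss x| + 2 * δ * Real.exp (-(1 / 8) * x ^ 2)
      + Real.log (√(2 * π)) * (p x - gauss x)
      + (p x * x ^ 2 - gauss x * x ^ 2) / 2) :=
  (((h2.add (hp.integrable_sub_gauss.abs.const_mul _)).add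
    ((integrable_exp_neg_mul_sq (b := 1 / 8) (by norm_num)).const_mul _)).add
    (hp.integrable_sub_gauss.const_mul _)).add
    ((hp.integrable_sq_mul.sub isUnitDensity_gauss.integrable_sq_mul).div_const 2)

lemma integrable_mul_log_div_gauss (hp : IsUnitDensity p)
    (h2 : Integrable (fun x => (p x - gauss x) ^ 2)) :
    Integrable (fun x => p x * Real.log (p x / gauss x)) :=
  integrable_of_le_of_le hp.measurable_mul_log_div_gauss.aestronglyMeasurable
    (ae_of_all _ hp.sub_gauss_le_mul_log)
    (ae_of_all _ (hp.mul_log_div_gauss_le one_pos))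
    hp.integrable_sub_gauss (hp.integrable_upper_bound h2 1)

lemma KLdiv_nonneg (hp : IsUnitDensity p)
    (h2 : Integrable (fun x => (p x - gauss x) ^ 2)) : 0 ≤ KLdiv p gauss := by
  rw [← hp.integral_sub_gauss]
  exact integral_mono hp.integrable_sub_gauss (hp.integrable_mul_log_div_gauss h2)
    hp.sub_gauss_le_mul_log

/-- Relative entropy is controlled by the `L¹` and `L²` distances to the Gaussian density. -/
lemma KLdiv_le_integral (hp : IsUnitDensity p)
    (h2 : Integrable (fun x => (p x - gauss x) ^ 2)) {δ : ℝ} (hδ : 0 < δ) :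
    KLdiv p gauss ≤ (2 + 2 * (δ ^ 2)⁻¹) *
        ((∫ x, |p x - gauss x|) + ∫ x, (p x - gauss x) ^ 2)
      + 2 * δ * ∫ x : ℝ, Real.exp (-(1 / 8) * x ^ 2) := by
  have i1 := hp.integrable_sub_gauss.abs.const_mul (2 + 2 * (δ ^ 2)⁻¹)
  have i2 := (integrable_exp_neg_mul_sq (b := 1 / 8) (by norm_num)).const_mul (2 * δ)
  have i3 := hp.integrable_sub_gauss.const_mul (Real.log (√(2 * π)))
  have i4 := (hp.integrable_sq_mul.sub isUnitDensity_gauss.integrable_sq_mul).div_const 2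
  have e := integral_add (((h2.add i1).add i2).add i3) i4
  rw [integral_add' ((h2.add i1).add i2) i3, integral_add' (h2.add i1) i2, integral_add' h2 i1,
    integral_const_mul, integral_const_mul, integral_const_mul, integral_div,
    integral_sub' hp.integrable_sq_mul isUnitDensity_gauss.integrable_sq_mul,
    hp.integral_sq_mul, isUnitDensity_gauss.integral_sq_mul, hp.integral_sub_gauss] at e
  have h := (integral_mono (hp.integrable_mul_log_div_gauss h2) (hp.integrable_upper_bound h2 δ)
    (hp.mul_log_div_gauss_le hδ)).trans_eq e
  have h0 : 0 ≤ ∫ x, (p x - gauss x) ^ 2 := integral_nonneg fun x => sq_nonneg _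
  have h1 : 0 ≤ (δ ^ 2)⁻¹ * ∫ x, (p x - gauss x) ^ 2 := by positivity
  rw [KLdiv]
  linarith

/-- A form of Pinsker's inequality. -/
lemma integral_abs_sub_gauss_le_KLdiv (hp : IsUnitDensity p)
    (h2 : Integrable (fun x => (p x - gauss x) ^ 2)) {δ : ℝ} (hδ : 0 < δ) :
    ∫ x, |p x - gauss x| ≤ δ⁻¹ * KLdiv p gauss + 2 * δ := by
  have hK := hp.integrable_mul_log_div_gauss h2
  have i1 := (hK.sub hp.integrable_sub_gauss).const_mul δ⁻¹
  have i2 := (hp.integrable.add isUnitDensity_gauss.integrable).const_mul δ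
  refine (integral_mono hp.integrable_sub_gauss.abs (i1.add i2)
    fun x => abs_sub_le_of_mul_log (hp.nonneg x) (gauss_pos x) hδ).trans_eq ?_
  have e := integral_add i1 i2
  simp only [Pi.add_apply, Pi.sub_apply] at e ⊢
  rw [e, integral_const_mul, integral_const_mul, integral_sub hK hp.integrable_sub_gauss,
    integral_add hp.integrable isUnitDensity_gauss.integrable, hp.integral_sub_gauss,
    hp.integral_eq_one, isUnitDensity_gauss.integral_eq_one, KLdiv]
  ring

lemma eLpNorm_one_sub_gauss (hp : IsUnitDensity p) :
    eLpNorm (fun x => p x - gauss x) 1 volume = ENNReal.ofReal (∫ x, |p x - gauss x|) := by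
  rw [eLpNorm_one_eq_lintegral_enorm, ← ofReal_integral_norm_eq_lintegral_enorm
    hp.integrable_sub_gauss]
  rfl

end IsUnitDensity

lemma eLpNorm_two_eq_ofReal_sqrt {f : ℝ → ℝ} (hf : Measurable f)
    (h2 : Integrable (fun x => f x ^ 2)) :
    eLpNorm f 2 volume = ENNReal.ofReal (√(∫ x, f x ^ 2)) := by
  rw [((memLp_two_iff_integrable_sq hf.aestronglyMeasurable).2 h2).eLpNorm_eq_integral_rpow_norm
    (by norm_num) (by norm_num), Real.sqrt_eq_rpow]
  simp

lemma tendsto_ofReal_zero_iff {g : ℕ → ℝ} (hg : ∀ n, 0 ≤ g n) :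
    Tendsto (fun n => ENNReal.ofReal (g n)) atTop (nhds 0) ↔ Tendsto g atTop (nhds 0) := by
  rw [← ENNReal.tendsto_toReal_zero_iff (by simp)]
  simp only [ENNReal.toReal_ofReal (hg _)]

lemma tendsto_sqrt_zero_iff {g : ℕ → ℝ} (hg : ∀ n, 0 ≤ g n) :
    Tendsto (fun n => √(g n)) atTop (nhds 0) ↔ Tendsto g atTop (nhds 0) := by
  constructor
  · intro h
    have := h.pow 2
    simpa [Real.sq_sqrt (hg _)] using this
  · intro h
    simpa using h.sqrt

lemma tendsto_zero_of_forall_eventually_le {g d : ℕ → ℝ} (hg : ∀ᶠ n in atTop, 0 ≤ g n)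
    (hd : Tendsto d atTop (nhds 0))
    (h : ∀ ε > 0, ∃ M : ℝ, ∀ᶠ n in atTop, g n ≤ M * d n + ε) :
    Tendsto g atTop (nhds 0) := by
  rw [Metric.tendsto_nhds]
  intro ε hε
  obtain ⟨M, hM⟩ := h (ε / 2) (by positivity)
  have hMd : Tendsto (fun n => M * d n) atTop (nhds 0) := by simpa using hd.const_mul M
  filter_upwards [hg, hM, hMd.eventually (gt_mem_nhds (half_pos hε))] with n h0 h1 h2
  rw [Real.dist_eq, sub_zero, abs_of_nonneg h0]
  linarith

lemma sq_le_mul_abs_add_rpow {r q M : ℝ} (hq : 2 < q) (hM : 0 < M) :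
    r ^ 2 ≤ M * |r| + M ^ (-(q - 2)) * |r| ^ q := by
  have h0 : 0 ≤ M ^ (-(q - 2)) * |r| ^ q := by positivity
  rcases le_or_gt |r| M with h | h
  · nlinarith [abs_nonneg r, sq_abs r]
  · have hr : 0 < |r| := hM.trans h
    have h1 : M ^ (q - 2) ≤ |r| ^ (q - 2) := Real.rpow_le_rpow hM.le h.le (by linarith)
    have h2 : |r| ^ q = |r| ^ 2 * |r| ^ (q - 2) := by
      rw [← Real.rpow_natCast, ← Real.rpow_add hr]; norm_num
    have h3 : M ^ (-(q - 2)) * M ^ (q - 2) = 1 := by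
      rw [← Real.rpow_add hM]; simp
    have h4 : 1 ≤ M ^ (-(q - 2)) * |r| ^ (q - 2) := by
      rw [← h3]; gcongr
    have h5 : |r| ^ 2 ≤ M ^ (-(q - 2)) * |r| ^ q := by
      rw [h2]; nlinarith [sq_nonneg |r|]
    rw [sq_abs] at h5
    have : 0 ≤ M * |r| := by positivity
    linarith

lemma exists_integral_sq_le_of_eLpNorm_le {f : ℕ → ℝ → ℝ} (hf : ∀ n, Integrable (f n))
    {q K : ℝ≥0∞} (hq : 2 < q) (hK : K < ⊤) (hfK : ∀ n, eLpNorm (f n) q volume ≤ K)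
    {ε : ℝ} (hε : 0 < ε) :
    ∃ M : ℝ, ∀ n, Integrable (fun x => f n x ^ 2) ∧
      ∫ x, f n x ^ 2 ≤ M * (∫ x, |f n x|) + ε := by
  have hm : ∀ n, AEStronglyMeasurable (fun x => f n x ^ 2) volume :=
    fun n => (hf n).aestronglyMeasurable.pow 2
  rcases eq_or_ne q ⊤ with rfl | hqt
  · refine ⟨K.toReal, fun n => ?_⟩
    have hb : ∀ᵐ x, f n x ^ 2 ≤ K.toReal * |f n x| := by
      filter_upwards [ae_le_eLpNormEssSup (f := f n) (μ := volume)] with x hx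
      have hx' : ‖f n x‖ₑ ≤ K := hx.trans (by simpa using hfK n)
      have h1 : |f n x| ≤ K.toReal := by
        have := ENNReal.toReal_mono hK.ne hx'
        simpa using this
      nlinarith [abs_nonneg (f n x), sq_abs (f n x)]
    have i1 := (hf n).abs.const_mul K.toReal
    have i2 : Integrable (fun x => f n x ^ 2) := by
      refine i1.mono' (hm n) ?_
      filter_upwards [hb] with x hx
      rwa [Real.norm_of_nonneg (sq_nonneg _)]
    refine ⟨i2, ?_⟩
    have := integral_mono_ae i2 i1 hb
    rw [integral_const_mul] at this
    linarith
  · have hq2 : 2 < q.toReal := by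
      simpa using (ENNReal.toReal_lt_toReal (by norm_num) hqt).2 hq
    have hq0 : q ≠ 0 := (lt_trans (by norm_num) hq).ne'
    have hlim : Tendsto (fun M : ℝ => M ^ (-(q.toReal - 2)) * K.toReal ^ q.toReal) atTop
        (nhds 0) := by
      simpa using (tendsto_rpow_neg_atTop (sub_pos.2 hq2)).mul_const (K.toReal ^ q.toReal)
    obtain ⟨M, hMε, hM⟩ :=
      ((hlim.eventually (gt_mem_nhds hε)).and (eventually_gt_atTop 0)).exists
    refine ⟨M, fun n => ?_⟩
    have hL : MemLp (f n) q volume :=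
      ⟨(hf n).aestronglyMeasurable, (hfK n).trans_lt hK⟩
    have iq : Integrable (fun x => |f n x| ^ q.toReal) := hL.integrable_norm_rpow hq0 hqt
    have hI : ∫ x, |f n x| ^ q.toReal ≤ K.toReal ^ q.toReal := by
      have h1 := ENNReal.toReal_mono hK.ne (hfK n)
      rw [hL.eLpNorm_eq_integral_rpow_norm hq0 hqt, ENNReal.toReal_ofReal (by positivity)] at h1
      have h2 := Real.rpow_le_rpow (by positivity) h1 (by linarith : 0 ≤ q.toReal)
      rwa [Real.rpow_inv_rpow (by positivity) (by linarith)] at h2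
    have i1 := (hf n).abs.const_mul M
    have i3 := iq.const_mul (M ^ (-(q.toReal - 2)))
    have i2 : Integrable (fun x => f n x ^ 2) := by
      refine (i1.add i3).mono' (hm n) (ae_of_all _ fun x => ?_)
      rw [Real.norm_of_nonneg (sq_nonneg _)]
      exact sq_le_mul_abs_add_rpow hq2 hM
    refine ⟨i2, ?_⟩
    have h1 := integral_mono i2 (i1.add i3) fun x => sq_le_mul_abs_add_rpow hq2 hM
    have e := integral_add i1 i3
    simp only [Pi.add_apply] at h1 e
    rw [e, integral_const_mul, integral_const_mul] at h1
    have : M ^ (-(q.toReal - 2)) * ∫ x, |f n x| ^ q.toReal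
        ≤ M ^ (-(q.toReal - 2)) * K.toReal ^ q.toReal := by gcongr
    linarith

lemma eventually_integral_sq_le_of_limsup_eLpNorm_le {p : ℕ → ℝ → ℝ}
    (hp : ∀ n, IsUnitDensity (p n))
    (h : limsup (fun n => eLpNorm (p n) 2 volume) atTop ≤ eLpNorm gauss 2 volume)
    {ε : ℝ} (hε : 0 < ε) :
    ∀ᶠ n in atTop, Integrable (fun x => (p n x - gauss x) ^ 2) ∧
      ∫ x, (p n x - gauss x) ^ 2 ≤ 2 * (∫ x, |p n x - gauss x|) + ε := by
  have hg := isUnitDensity_gauss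
  have hg0 : 0 ≤ ∫ x, gauss x ^ 2 := integral_nonneg fun x => sq_nonneg _
  rw [eLpNorm_two_eq_ofReal_sqrt hg.measurable integrable_gauss_sq] at h
  have hlt : limsup (fun n => eLpNorm (p n) 2 volume) atTop
      < ENNReal.ofReal (√((∫ x, gauss x ^ 2) + ε)) := by
    refine h.trans_lt ?_
    rw [ENNReal.ofReal_lt_ofReal_iff (Real.sqrt_pos.2 (by linarith))]
    exact Real.sqrt_lt_sqrt hg0 (by linarith)
  filter_upwards [eventually_lt_of_limsup_lt hlt] with n hn
  have hL : MemLp (p n) 2 volume :=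
    ⟨(hp n).measurable.aestronglyMeasurable, hn.trans ENNReal.ofReal_lt_top⟩
  have hLg : MemLp gauss 2 volume :=
    (memLp_two_iff_integrable_sq hg.measurable.aestronglyMeasurable).2 integrable_gauss_sq
  have i2 : Integrable (fun x => (p n x - gauss x) ^ 2) := (hL.sub hLg).integrable_sq
  have ip := hL.integrable_sq
  rw [eLpNorm_two_eq_ofReal_sqrt (hp n).measurable ip,
    ENNReal.ofReal_lt_ofReal_iff (Real.sqrt_pos.2 (by linarith)),
    Real.sqrt_lt_sqrt_iff (integral_nonneg fun x => sq_nonneg _)] at hn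
  refine ⟨i2, ?_⟩
  have i1 := (hp n).integrable_sub_gauss.abs.const_mul 2
  have hb : ∀ x, (p n x - gauss x) ^ 2 ≤
      p n x ^ 2 - gauss x ^ 2 + 2 * |p n x - gauss x| := by
    intro x
    have h1 : -(p n x - gauss x) * gauss x ≤ |p n x - gauss x| * gauss x :=
      mul_le_mul_of_nonneg_right (neg_le_abs _) (gauss_pos x).le
    nlinarith [mul_nonneg (abs_nonneg (p n x - gauss x)) (sub_nonneg.2 (gauss_le_one x))]
  have h1 := integral_mono i2 ((ip.sub integrable_gauss_sq).add i1) hb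
  have e := integral_add (ip.sub integrable_gauss_sq) i1
  simp only [Pi.add_apply, Pi.sub_apply] at h1 e
  rw [e, integral_sub ip integrable_gauss_sq, integral_const_mul] at h1
  linarith

/-- **Corollary 2.5.** Let `X_n` have densities `p_n`, `E X_n = 0`, `Var X_n = 1`, and
`sup_n E|X_n|^s < ∞` for some `s > 2`.  If either (i) `sup_n ‖p_n − φ‖_q < ∞` for some
`2 < q ≤ ∞`, or (ii) `limsup_n ‖p_n‖₂ ≤ ‖φ‖₂`, then the following are equivalent:
(1) `‖p_n − φ‖₁ → 0`;  (2) `‖p_n − φ‖₂ → 0`;  (3) `KL(X_n‖G) → 0`. -/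
theorem equivalence_L1_L2_KL_gaussian
    {Ω : Type*} [MeasurableSpace Ω] (P : Measure Ω) [IsProbabilityMeasure P]
    (X : ℕ → Ω → ℝ) (p : ℕ → ℝ → ℝ) (hX : ∀ n, IsDensityOf P (X n) (p n))
    (hmean : ∀ n, ∫ ω, X n ω ∂P = 0)
    (hvarint : ∀ n, Integrable (fun ω => (X n ω) ^ 2) P)
    (hvar : ∀ n, ∫ ω, (X n ω) ^ 2 ∂P = 1)
    (s : ℝ) (hs : 2 < s) (C : ℝ)
    (hint : ∀ n, Integrable (fun ω => |X n ω| ^ s) P)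
    (hmom : ∀ n, ∫ ω, |X n ω| ^ s ∂P ≤ C)
    (hcase :
      (∃ q : ℝ≥0∞, 2 < q ∧ ∃ K : ℝ≥0∞, K < ⊤ ∧
          ∀ n, eLpNorm (fun x => p n x - gauss x) q volume ≤ K) ∨
      Filter.limsup (fun n => eLpNorm (p n) 2 volume) atTop ≤ eLpNorm gauss 2 volume) :
    (Tendsto (fun n => eLpNorm (fun x => p n x - gauss x) 1 volume) atTop (nhds 0) ↔
      Tendsto (fun n => eLpNorm (fun x => p n x - gauss x) 2 volume) atTop (nhds 0)) ∧
    (Tendsto (fun n => eLpNorm (fun x => p n x - gauss x) 2 volume) atTop (nhds 0) ↔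
      Tendsto (fun n => KLdiv (p n) gauss) atTop (nhds 0)) := by
  have hp : ∀ n, IsUnitDensity (p n) := fun n => (hX n).isUnitDensity (hvarint n) (hvar n)
  have hA : ∀ ε > 0, ∃ M : ℝ, ∀ᶠ n in atTop, Integrable (fun x => (p n x - gauss x) ^ 2) ∧
      ∫ x, (p n x - gauss x) ^ 2 ≤ M * (∫ x, |p n x - gauss x|) + ε := by
    intro ε hε
    rcases hcase with ⟨q, hq, K, hK, hfK⟩ | hlim
    · obtain ⟨M, hM⟩ := exists_integral_sq_le_of_eLpNorm_le
        (fun n => (hp n).integrable_sub_gauss) hq hK hfK hε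
      exact ⟨M, Eventually.of_forall hM⟩
    · exact ⟨2, eventually_integral_sq_le_of_limsup_eLpNorm_le hp hlim hε⟩
  have hI : ∀ᶠ n in atTop, Integrable (fun x => (p n x - gauss x) ^ 2) :=
    let ⟨_, hM⟩ := hA 1 one_pos
    hM.mono fun _ h => h.1
  have hn1 : ∀ n, 0 ≤ ∫ x, |p n x - gauss x| := fun n => integral_nonneg fun x => abs_nonneg _
  have hn2 : ∀ n, 0 ≤ ∫ x, (p n x - gauss x) ^ 2 :=
    fun n => integral_nonneg fun x => sq_nonneg _
  have e1 : Tendsto (fun n => eLpNorm (fun x => p n x - gauss x) 1 volume) atTop (nhds 0) ↔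
      Tendsto (fun n => ∫ x, |p n x - gauss x|) atTop (nhds 0) := by
    simp only [(hp _).eLpNorm_one_sub_gauss]
    exact tendsto_ofReal_zero_iff hn1
  have e2 : Tendsto (fun n => eLpNorm (fun x => p n x - gauss x) 2 volume) atTop (nhds 0) ↔
      Tendsto (fun n => ∫ x, (p n x - gauss x) ^ 2) atTop (nhds 0) := by
    rw [← tendsto_sqrt_zero_iff hn2, ← tendsto_ofReal_zero_iff fun n => Real.sqrt_nonneg _]
    refine tendsto_congr' (hI.mono fun n hn => ?_)
    exact eLpNorm_two_eq_ofReal_sqrt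
      ((hp n).measurable.sub isUnitDensity_gauss.measurable) hn
  set W := ∫ x : ℝ, Real.exp (-(1 / 8) * x ^ 2)
  have hW0 : 0 ≤ W := integral_nonneg fun x => (Real.exp_pos _).le
  have hδ : ∀ ε > 0, 0 < ε / (2 * W + 1) ∧ 2 * (ε / (2 * W + 1)) * W ≤ ε := by
    intro ε hε
    refine ⟨by positivity, ?_⟩
    rw [mul_div_assoc', div_mul_eq_mul_div, div_le_iff₀ (by positivity)]
    nlinarith
  have h12 : Tendsto (fun n => ∫ x, |p n x - gauss x|) atTop (nhds 0) →
      Tendsto (fun n => ∫ x, (p n x - gauss x) ^ 2) atTop (nhds 0) := fun h =>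
    tendsto_zero_of_forall_eventually_le (Eventually.of_forall hn2) h fun ε hε =>
      let ⟨M, hM⟩ := hA ε hε
      ⟨M, hM.mono fun _ h => h.2⟩
  have h21 : Tendsto (fun n => ∫ x, (p n x - gauss x) ^ 2) atTop (nhds 0) →
      Tendsto (fun n => ∫ x, |p n x - gauss x|) atTop (nhds 0) := fun h =>
    tendsto_zero_of_forall_eventually_le (Eventually.of_forall hn1) h fun ε hε =>
      ⟨_, hI.mono fun n hn => ((hp n).integral_abs_sub_gauss_le hn (hδ ε hε).1).trans
        (by gcongr; exact (hδ ε hε).2)⟩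
  rw [e1, e2]
  refine ⟨⟨h12, h21⟩, fun h => ?_, fun h => h12 ?_⟩
  · have hd := (h21 h).add h
    rw [add_zero] at hd
    exact tendsto_zero_of_forall_eventually_le (hI.mono fun n hn => (hp n).KLdiv_nonneg hn) hd
      fun ε hε => ⟨_, hI.mono fun n hn => ((hp n).KLdiv_le_integral hn (hδ ε hε).1).trans
        (by gcongr; exact (hδ ε hε).2)⟩
  · exact tendsto_zero_of_forall_eventually_le (Eventually.of_forall hn1) h
      fun ε hε => ⟨(ε / 2)⁻¹, hI.mono fun n hn =>
        ((hp n).integral_abs_sub_gauss_le_KLdiv hn (half_pos hε)).trans_eq (by ring)⟩
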